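/- arXiv:1011.2081 — 2 statements merged into one kernel-verified Lean document; each statement's English description precedes it below -/
import Mathlib

section
/- Let σ be a positive Borel measure on ℝ with ∫_ℝ dσ(s)/(s²+1) < ∞, let a ∈ ℝ and b ≥ 0, and define M(z) = a + b·z + ∫_ℝ (1/(s−z) − s/(s²+1)) dσ(s). Assume σ((−γ, 0)) = 0 for some γ > 0, σ({0}) = 0, and ∫_{(0,1/2)} dσ(s)/s < ∞. Let R(z) = z²·M(z). Then lim_{x↑0} M(x) = a + ∫_{ℝ∖{0}} dσ(s)/(s(s²+1)) ∈ ℝ, and lim_{x↑0} R′(x)/x = 2·lim_{x↑0} M(x). -/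
open Complex MeasureTheory Filter Set

/-- The Nevanlinna kernel `1 / (s - z) - s / (s² + 1)`. -/
noncomputable def nevanlinnaKernel (z : ℂ) (s : ℝ) : ℂ :=
  ((s : ℂ) - z)⁻¹ - (s : ℂ) / ((s : ℂ) ^ 2 + 1)

lemma ofReal_sq_add_one_ne_zero (s : ℝ) : (s : ℂ) ^ 2 + 1 ≠ 0 := by
  have h : s ^ 2 + 1 ≠ 0 := by positivity
  exact_mod_cast h

lemma nevanlinnaKernel_eq_div {z : ℂ} {s : ℝ} (h : (s : ℂ) - z ≠ 0) :
    nevanlinnaKernel z s = (1 + s * z) / ((s - z) * ((s : ℂ) ^ 2 + 1)) := by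
  have h2 := ofReal_sq_add_one_ne_zero s
  unfold nevanlinnaKernel
  field_simp
  ring

lemma measurable_nevanlinnaKernel (z : ℂ) : Measurable (nevanlinnaKernel z) := by
  unfold nevanlinnaKernel
  fun_prop

lemma hasDerivAt_nevanlinnaKernel {z : ℂ} {s : ℝ} (h : (s : ℂ) - z ≠ 0) :
    HasDerivAt (fun w => nevanlinnaKernel w s) ((((s : ℂ) - z) ^ 2)⁻¹) z := by
  have h1 : HasDerivAt (fun w : ℂ => (s : ℂ) - w) (-1) z := by
    simpa using (hasDerivAt_id z).const_sub (s : ℂ)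
  simpa [nevanlinnaKernel, neg_div, one_div] using
    (h1.inv h).sub_const ((s : ℂ) / ((s : ℂ) ^ 2 + 1))

lemma ae_le_neg_or_pos {σ : Measure ℝ} {γ : ℝ} (hgap : σ (Ioo (-γ) 0) = 0)
    (hpoint : σ {0} = 0) : ∀ᵐ s ∂σ, s ≤ -γ ∨ 0 < s := by
  have h1 : ∀ᵐ s ∂σ, s ∉ Ioo (-γ) 0 := measure_eq_zero_iff_ae_notMem.1 hgap
  have h2 : ∀ᵐ s ∂σ, s ∉ ({0} : Set ℝ) := measure_eq_zero_iff_ae_notMem.1 hpoint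
  filter_upwards [h1, h2] with s hs hs'
  by_contra! h
  exact hs ⟨h.1, lt_of_le_of_ne h.2 hs'⟩

lemma gap_abs_bounds {γ x s : ℝ} (hx : -(γ / 2) < x) (hx0 : x < 0)
    (hs : s ≤ -γ ∨ 0 < s) : |s| ≤ 2 * |s - x| ∧ |x| ≤ |s - x| ∧ 0 < |s| ∧ 0 < |s - x| := by
  rcases hs with hs | hs
  · rw [abs_of_neg (by linarith : s < 0), abs_of_neg (by linarith : s - x < 0), abs_of_neg hx0]
    refine ⟨?_, ?_, ?_, ?_⟩ <;> linarith
  · rw [abs_of_pos hs, abs_of_pos (by linarith : 0 < s - x), abs_of_neg hx0]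
    refine ⟨?_, ?_, ?_, ?_⟩ <;> linarith

lemma integrable_inv_mul_sq_add_one {σ : Measure ℝ} {γ : ℝ} (hγ : 0 < γ)
    (hσ : Integrable (fun s : ℝ => (s ^ 2 + 1)⁻¹) σ)
    (hae : ∀ᵐ s ∂σ, s ≤ -γ ∨ 0 < s)
    (hconv : ∫⁻ s in Ioo (0 : ℝ) (1 / 2), ENNReal.ofReal s⁻¹ ∂σ ≠ ⊤) :
    Integrable (fun s : ℝ => (s * (s ^ 2 + 1))⁻¹) σ := by
  have hinv : IntegrableOn (fun s : ℝ => s⁻¹) (Ioo 0 (1 / 2)) σ := by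
    refine ⟨by fun_prop, ?_⟩
    rw [hasFiniteIntegral_iff_ofReal]
    · exact hconv.lt_top
    · filter_upwards [ae_restrict_mem measurableSet_Ioo] with s hs
      exact inv_nonneg.2 hs.1.le
  refine ((hinv.integrable_indicator measurableSet_Ioo).add
    (hσ.const_mul (2 + γ⁻¹))).mono' (by fun_prop) ?_
  filter_upwards [hae] with s hs
  have hq : 0 < s ^ 2 + 1 := by positivity
  have hγ' : 0 < γ⁻¹ := inv_pos.2 hγ
  rw [norm_inv, norm_mul, Real.norm_of_nonneg hq.le, mul_inv, Real.norm_eq_abs, Pi.add_apply]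
  by_cases hmem : s ∈ Ioo (0 : ℝ) (1 / 2)
  · rw [indicator_of_mem hmem, abs_of_pos hmem.1]
    have h1 : (s ^ 2 + 1)⁻¹ ≤ 1 := inv_le_one_of_one_le₀ (by nlinarith [sq_nonneg s])
    have h2 : 0 < s⁻¹ := inv_pos.2 hmem.1
    have h3 : 0 < (s ^ 2 + 1)⁻¹ := inv_pos.2 hq
    nlinarith [mul_pos (by positivity : 0 < 2 + γ⁻¹) h3]
  · rw [indicator_of_notMem hmem, zero_add]
    refine mul_le_mul_of_nonneg_right ?_ (inv_nonneg.2 hq.le)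
    rcases hs with hs | hs
    · have : |s|⁻¹ ≤ γ⁻¹ := inv_anti₀ hγ (by rw [abs_of_neg (by linarith)]; linarith)
      linarith
    · have h : 1 / 2 ≤ s := by
        by_contra! h
        exact hmem ⟨hs, h⟩
      have : |s|⁻¹ ≤ (1 / 2)⁻¹ := inv_anti₀ (by norm_num) (by rw [abs_of_pos hs]; exact h)
      norm_num at this
      linarith

lemma norm_nevanlinnaKernel_le {γ x s : ℝ} (hx : -(γ / 2) < x) (hx0 : x < 0)
    (hs : s ≤ -γ ∨ 0 < s) :
    ‖nevanlinnaKernel x s‖ ≤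
      2 * ‖(s * (s ^ 2 + 1))⁻¹‖ + 2 * |x| * (s ^ 2 + 1)⁻¹ := by
  obtain ⟨h1, -, h3, h4⟩ := gap_abs_bounds hx hx0 hs
  have hq : 0 < s ^ 2 + 1 := by positivity
  have hne : (s : ℂ) - x ≠ 0 := by exact_mod_cast abs_pos.1 h4
  have hcast : nevanlinnaKernel x s = (((1 + s * x) / ((s - x) * (s ^ 2 + 1)) : ℝ) : ℂ) := by
    rw [nevanlinnaKernel_eq_div hne]
    push_cast
    rfl
  rw [hcast, norm_real, norm_div, norm_mul, norm_inv, norm_mul, Real.norm_of_nonneg hq.le]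
  simp only [Real.norm_eq_abs]
  have hnum : |1 + s * x| ≤ 1 + |s| * |x| := by
    simpa [abs_mul] using abs_add_le 1 (s * x)
  calc |1 + s * x| / (|s - x| * (s ^ 2 + 1))
      ≤ (1 + |s| * |x|) / (|s| / 2 * (s ^ 2 + 1)) := by gcongr; linarith
    _ = 2 * (|s| * (s ^ 2 + 1))⁻¹ + 2 * |x| * (s ^ 2 + 1)⁻¹ := by field_simp

lemma norm_mul_inv_sub_sq_le {γ x s : ℝ} (hx : -(γ / 2) < x) (hx0 : x < 0)
    (hs : s ≤ -γ ∨ 0 < s) :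
    ‖(x : ℂ) * (((s : ℂ) - x) ^ 2)⁻¹‖ ≤
      2 * ‖(s * (s ^ 2 + 1))⁻¹‖ + 4 * |x| * (s ^ 2 + 1)⁻¹ := by
  obtain ⟨h1, h2, h3, h4⟩ := gap_abs_bounds hx hx0 hs
  have hq : 0 < s ^ 2 + 1 := by positivity
  have hcast : (x : ℂ) * (((s : ℂ) - x) ^ 2)⁻¹ = ((x * ((s - x) ^ 2)⁻¹ : ℝ) : ℂ) := by
    push_cast
    rfl
  rw [hcast, norm_real, norm_mul, norm_inv, norm_pow, norm_inv, norm_mul,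
    Real.norm_of_nonneg hq.le]
  simp only [Real.norm_eq_abs]
  have hsplit : 2 * (|s| * (s ^ 2 + 1))⁻¹ + 4 * |x| * (s ^ 2 + 1)⁻¹ =
      (2 + 4 * |x| * |s|) / (|s| * (s ^ 2 + 1)) := by field_simp
  rw [hsplit, ← div_eq_mul_inv, div_le_div_iff₀ (by positivity) (by positivity), ← sq_abs s]
  have hlin : |x| * |s| ≤ 2 * |s - x| ^ 2 := by nlinarith [abs_nonneg x]
  have hsq : |s| ^ 2 ≤ 4 * |s - x| ^ 2 := by nlinarith
  nlinarith [mul_le_mul_of_nonneg_left hsq (mul_nonneg (abs_nonneg x) h3.le)]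

lemma tendsto_integral_of_gap_bound {σ : Measure ℝ} {γ C : ℝ} (hγ : 0 < γ)
    (hσ : Integrable (fun s : ℝ => (s ^ 2 + 1)⁻¹) σ)
    (hg : Integrable (fun s : ℝ => (s * (s ^ 2 + 1))⁻¹) σ)
    (hae : ∀ᵐ s ∂σ, s ≤ -γ ∨ 0 < s) (hC : 0 ≤ C) {F : ℝ → ℝ → ℂ} {f : ℝ → ℂ}
    (hF : ∀ x, Measurable (F x))
    (hbound : ∀ x s, -(γ / 2) < x → x < 0 → s ≤ -γ ∨ 0 < s →
      ‖F x s‖ ≤ 2 * ‖(s * (s ^ 2 + 1))⁻¹‖ + C * |x| * (s ^ 2 + 1)⁻¹)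
    (hlim : ∀ s, s ≠ 0 → Tendsto (fun x => F x s) (nhds 0) (nhds (f s))) :
    Tendsto (fun x => ∫ s, F x s ∂σ) (nhdsWithin 0 (Iio 0)) (nhds (∫ s, f s ∂σ)) := by
  refine tendsto_integral_filter_of_dominated_convergence
    (fun s => 2 * ‖(s * (s ^ 2 + 1))⁻¹‖ + C * (γ / 2) * (s ^ 2 + 1)⁻¹)
    (Eventually.of_forall fun x => (hF x).aestronglyMeasurable) ?_
    ((hg.norm.const_mul 2).add (hσ.const_mul _)) ?_
  · filter_upwards [Ioo_mem_nhdsLT (by linarith : -(γ / 2) < 0)] with x hx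
    filter_upwards [hae] with s hs
    refine (hbound x s hx.1 hx.2 hs).trans ?_
    have : |x| ≤ γ / 2 := by rw [abs_of_neg hx.2]; linarith [hx.1]
    gcongr
  · filter_upwards [hae] with s hs
    have hs0 : s ≠ 0 := by rcases hs with hs | hs <;> intro h <;> linarith
    exact (hlim s hs0).mono_left nhdsWithin_le_nhds

lemma hasDerivAt_integral_nevanlinnaKernel {σ : Measure ℝ} {γ x : ℝ}
    (hσ : Integrable (fun s : ℝ => (s ^ 2 + 1)⁻¹) σ)
    (hg : Integrable (fun s : ℝ => (s * (s ^ 2 + 1))⁻¹) σ)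
    (hae : ∀ᵐ s ∂σ, s ≤ -γ ∨ 0 < s) (hx : -(γ / 4) < x) (hx0 : x < 0) :
    HasDerivAt (fun z => ∫ s, nevanlinnaKernel z s ∂σ)
      (∫ s : ℝ, (((s : ℂ) - x) ^ 2)⁻¹ ∂σ) x := by
  have hlower : ∀ z ∈ Metric.ball (x : ℂ) (-x / 2), ∀ s : ℝ, s ≤ -γ ∨ 0 < s →
      |s| ≤ 2 * ‖(s : ℂ) - z‖ ∧ -x / 2 ≤ ‖(s : ℂ) - z‖ := by
    intro z hz s hs
    have hre : |z.re - x| < -x / 2 := by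
      refine lt_of_le_of_lt ?_ (mem_ball_iff_norm.1 hz)
      simpa using abs_re_le_norm (z - x)
    obtain ⟨hl, hr⟩ := abs_lt.1 hre
    obtain ⟨h1, h2, -, -⟩ := gap_abs_bounds (γ := γ) (x := z.re) (by linarith) (by linarith) hs
    have h3 : |s - z.re| ≤ ‖(s : ℂ) - z‖ := by simpa using abs_re_le_norm ((s : ℂ) - z)
    have h4 : -x / 2 ≤ |z.re| := by rw [abs_of_neg (by linarith)]; linarith
    constructor <;> linarith
  refine (hasDerivAt_integral_of_dominated_loc_of_deriv_le
    (F' := fun z s => (((s : ℂ) - z) ^ 2)⁻¹)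
    (bound := fun s => (4 + 4 / x ^ 2) * (s ^ 2 + 1)⁻¹)
    (Metric.ball_mem_nhds _ (by linarith : 0 < -x / 2))
    (Eventually.of_forall fun z => (measurable_nevanlinnaKernel z).aestronglyMeasurable)
    ?_ (by fun_prop) ?_ (hσ.const_mul _) ?_).2
  · refine ((hg.norm.const_mul 2).add (hσ.const_mul (2 * |x|))).mono'
      (measurable_nevanlinnaKernel _).aestronglyMeasurable ?_
    filter_upwards [hae] with s hs
    exact norm_nevanlinnaKernel_le (by linarith) hx0 hs
  · filter_upwards [hae] with s hs z hz
    obtain ⟨h1, h2⟩ := hlower z hz s hs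
    have hpos : 0 < ‖(s : ℂ) - z‖ := by linarith
    have hsq : s ^ 2 ≤ 4 * ‖(s : ℂ) - z‖ ^ 2 := by
      rw [← sq_abs]
      nlinarith [abs_nonneg s]
    have hone : 1 ≤ 4 / x ^ 2 * ‖(s : ℂ) - z‖ ^ 2 := by
      rw [div_mul_eq_mul_div, le_div_iff₀ (by nlinarith)]
      nlinarith
    rw [norm_inv, norm_pow, ← div_eq_mul_inv, inv_eq_one_div,
      div_le_div_iff₀ (by positivity) (by positivity)]
    linarith
  · filter_upwards [hae] with s hs z hz
    have h := (hlower z hz s hs).2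
    exact hasDerivAt_nevanlinnaKernel (norm_pos_iff.1 (by linarith))

/-- Let `M` be the Nevanlinna function with integral representation
data `(a, b, σ)`, suppose `(−γ, 0)` is a gap of `σ`, `σ({0}) = 0` and
`∫_{(0,1/2)} dσ(s)/s < ∞`, and let `R(z) = z² M(z)`. Then
`M(x) → a + ∫_{ℝ∖{0}} dσ(s)/(s(s²+1)) ∈ ℝ` as `x ↑ 0`, and
`R′(x)/x → 2·lim_{x↑0} M(x)` as `x ↑ 0`. -/
theorem statement14 (σ : Measure ℝ) (a b : ℝ) (hb : 0 ≤ b)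
    (hσ : Integrable (fun s : ℝ => (s ^ 2 + 1)⁻¹) σ)
    (γ : ℝ) (hγ : 0 < γ) (hgap : σ (Set.Ioo (-γ) 0) = 0)
    (hpoint : σ {0} = 0)
    (hconv : ∫⁻ s in Set.Ioo (0 : ℝ) (1 / 2), ENNReal.ofReal s⁻¹ ∂σ ≠ ⊤)
    (M : ℂ → ℂ)
    (hM : ∀ z : ℂ, z.im ≠ 0 ∨ (-γ < z.re ∧ z.re < 0) →
      M z = (a : ℂ) + (b : ℂ) * z +
        ∫ s : ℝ, (((s : ℂ) - z)⁻¹ - (s : ℂ) / ((s : ℂ) ^ 2 + 1)) ∂σ)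
    (R : ℂ → ℂ) (hR : ∀ z : ℂ, R z = z ^ 2 * M z) :
    IntegrableOn (fun s : ℝ => (s * (s ^ 2 + 1))⁻¹) {(0 : ℝ)}ᶜ σ ∧
    Tendsto (fun x : ℝ => (M (x : ℂ)).re) (nhdsWithin 0 (Set.Iio 0))
      (nhds (a + ∫ s in {(0 : ℝ)}ᶜ, (s * (s ^ 2 + 1))⁻¹ ∂σ)) ∧
    Tendsto (fun x : ℝ => (deriv R (x : ℂ)).re / x) (nhdsWithin 0 (Set.Iio 0))
      (nhds (2 * (a + ∫ s in {(0 : ℝ)}ᶜ, (s * (s ^ 2 + 1))⁻¹ ∂σ))) := by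
  have hae := ae_le_neg_or_pos hgap hpoint
  have hg := integrable_inv_mul_sq_add_one hγ hσ hae hconv
  have hset : ∫ s in {(0 : ℝ)}ᶜ, (s * (s ^ 2 + 1))⁻¹ ∂σ = ∫ s, (s * (s ^ 2 + 1))⁻¹ ∂σ := by
    rw [Measure.restrict_eq_self_of_ae_mem]
    exact measure_eq_zero_iff_ae_notMem.1 hpoint
  have hgap_nhds : ∀ᶠ x : ℝ in nhdsWithin 0 (Iio 0), x ∈ Ioo (-(γ / 4)) 0 :=
    Ioo_mem_nhdsLT (by linarith)
  have hx_tendsto : Tendsto (fun x : ℝ => (x : ℂ)) (nhdsWithin 0 (Iio 0)) (nhds 0) := by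
    simpa using (continuous_ofReal.tendsto 0).mono_left nhdsWithin_le_nhds
  have hkernel : Tendsto (fun x : ℝ => ∫ s, nevanlinnaKernel x s ∂σ) (nhdsWithin 0 (Iio 0))
      (nhds (∫ s : ℝ, (((s * (s ^ 2 + 1))⁻¹ : ℝ) : ℂ) ∂σ)) := by
    refine tendsto_integral_of_gap_bound hγ hσ hg hae zero_le_two
      (fun x => measurable_nevanlinnaKernel x)
      (fun x s hx hx0 hs => norm_nevanlinnaKernel_le hx hx0 hs) fun s hs => ?_
    have hsne : (s : ℂ) - ((0 : ℝ) : ℂ) ≠ 0 := by simpa using hs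
    have hval : (((s * (s ^ 2 + 1))⁻¹ : ℝ) : ℂ) = nevanlinnaKernel ((0 : ℝ) : ℂ) s := by
      rw [nevanlinnaKernel_eq_div hsne]
      simp
    rw [hval]
    exact (hasDerivAt_nevanlinnaKernel hsne).continuousAt.tendsto.comp
      (continuous_ofReal.tendsto 0)
  have hsquare : Tendsto (fun x : ℝ => ∫ s : ℝ, (x : ℂ) * (((s : ℂ) - x) ^ 2)⁻¹ ∂σ)
      (nhdsWithin 0 (Iio 0)) (nhds 0) := by
    have h := tendsto_integral_of_gap_bound (f := fun _ => 0)
      (F := fun x s => (x : ℂ) * (((s : ℂ) - x) ^ 2)⁻¹) hγ hσ hg hae zero_le_four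
      (fun x => by fun_prop) (fun x s hx hx0 hs => norm_mul_inv_sub_sq_le hx hx0 hs) fun s hs => by
        have hsne : ((s : ℂ) - ((0 : ℝ) : ℂ)) ^ 2 ≠ 0 := by simpa using hs
        have hc : ContinuousAt (fun x : ℝ => (x : ℂ) * (((s : ℂ) - x) ^ 2)⁻¹) 0 :=
          ContinuousAt.mul (by fun_prop) (ContinuousAt.inv₀ (by fun_prop) hsne)
        simpa [ContinuousAt] using hc
    simpa using h
  have hMlim : Tendsto (fun x : ℝ => M x) (nhdsWithin 0 (Iio 0))
      (nhds ((a + ∫ s in {(0 : ℝ)}ᶜ, (s * (s ^ 2 + 1))⁻¹ ∂σ : ℝ) : ℂ)) := by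
    have h := ((hx_tendsto.const_mul (b : ℂ)).const_add (a : ℂ)).add hkernel
    rw [integral_complex_ofReal, mul_zero, add_zero, ← ofReal_add, ← hset] at h
    refine h.congr' ?_
    filter_upwards [hgap_nhds] with x hx
    exact (hM x (Or.inr (by simp only [ofReal_re]; exact ⟨by linarith [hx.1], hx.2⟩))).symm
  have hderiv : ∀ x ∈ Ioo (-(γ / 4)) (0 : ℝ), deriv R x / x =
      2 * M x + (x * b + ∫ s : ℝ, (x : ℂ) * (((s : ℂ) - x) ^ 2)⁻¹ ∂σ) := by
    intro x hx
    have hMd : HasDerivAt M (b + ∫ s : ℝ, (((s : ℂ) - x) ^ 2)⁻¹ ∂σ) x := by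
      have hlin : HasDerivAt (fun z : ℂ => (a : ℂ) + b * z) b x := by
        simpa using ((hasDerivAt_id (x : ℂ)).const_mul (b : ℂ)).const_add (a : ℂ)
      have hint := hasDerivAt_integral_nevanlinnaKernel hσ hg hae hx.1 hx.2
      refine (hlin.add hint).congr_of_eventuallyEq ?_
      have hopen : IsOpen (re ⁻¹' Ioo (-γ) 0) := isOpen_Ioo.preimage continuous_re
      have hmem : (x : ℂ) ∈ re ⁻¹' Ioo (-γ) 0 := by
        simp only [mem_preimage, ofReal_re]
        exact ⟨by linarith [hx.1, hx.2], hx.2⟩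
      filter_upwards [hopen.mem_nhds hmem] with z hz
      exact hM z (Or.inr hz)
    have hRd := ((hasDerivAt_pow 2 (x : ℂ)).mul hMd).deriv
    have hReq : R = (fun z => z ^ 2) * M := funext hR
    have hx0 : (x : ℂ) ≠ 0 := by exact_mod_cast hx.2.ne
    rw [hReq, hRd, integral_const_mul]
    field_simp
    ring
  refine ⟨hg.integrableOn, ?_, ?_⟩
  · exact (continuous_re.tendsto _).comp hMlim
  · have h := (hMlim.const_mul 2).add ((hx_tendsto.mul_const (b : ℂ)).add hsquare)
    rw [zero_mul, add_zero, add_zero] at h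
    have h' := (continuous_re.tendsto _).comp h
    have hval : (2 * ((a + ∫ s in {(0 : ℝ)}ᶜ, (s * (s ^ 2 + 1))⁻¹ ∂σ : ℝ) : ℂ)).re =
        2 * (a + ∫ s in {(0 : ℝ)}ᶜ, (s * (s ^ 2 + 1))⁻¹ ∂σ) := by simp
    rw [hval] at h'
    refine h'.congr' ?_
    filter_upwards [hgap_nhds] with x hx
    rw [Function.comp_apply, ← hderiv x hx, div_ofReal_re]
end

section
/- Let M be a Nevanlinna function, not identically zero, which extends holomorphically to (ℂ∖ℝ) ∪ (−γ, 0) for some γ > 0, and let R(z) = z²·M(z). Then lim_{x↑0} R′(x)/R(x) = −∞ (the quotient is defined for x < 0 sufficiently close to 0, since R has at most one zero in each interval (−ε, 0)). -/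
open Complex Filter Set

/-- A holomorphic map from the unit disc to the right half-plane satisfies the Schwarz–Pick
bound at the origin. -/
theorem norm_deriv_zero_le_of_re_pos {g : ℂ → ℂ} (hg : DifferentiableOn ℂ g (Metric.ball 0 1))
    (hre : ∀ z ∈ Metric.ball (0 : ℂ) 1, 0 < (g z).re) {m : ℝ} (hm : g 0 = m) :
    ‖deriv g 0‖ ≤ 2 * m := by
  have h0 : (0 : ℂ) ∈ Metric.ball (0 : ℂ) 1 := by simp
  have hmpos : 0 < m := by simpa [hm] using hre 0 h0
  have hne : ∀ z ∈ Metric.ball (0 : ℂ) 1, g z + m ≠ 0 := by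
    intro z hz h
    have h1 := congrArg Complex.re h
    have h2 := hre z hz
    simp at h1
    linarith
  set G : ℂ → ℂ := fun z => (g z - m) / (g z + m) with hG
  have hGd : DifferentiableOn ℂ G (Metric.ball 0 1) :=
    (hg.sub_const _).div (hg.add_const _) hne
  have hG0 : G 0 = 0 := by simp [hG, hm]
  have hmaps : MapsTo G (Metric.ball 0 1) (Metric.ball (G 0) 1) := by
    intro z hz
    have hp := hre z hz
    rw [hG0, mem_ball_zero_iff, hG]
    simp only [norm_div]
    rw [div_lt_one (norm_pos_iff.2 (hne z hz)), ← sq_lt_sq₀ (norm_nonneg _) (norm_nonneg _),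
      Complex.sq_norm, Complex.sq_norm, normSq_apply, normSq_apply]
    simp
    nlinarith [mul_pos hp hmpos]
  have hS := norm_deriv_le_div_of_mapsTo_ball hGd
    (hmaps.mono_right Metric.ball_subset_closedBall) one_pos
  have hgd : HasDerivAt g (deriv g 0) 0 :=
    (hg.differentiableAt (Metric.ball_mem_nhds _ one_pos)).hasDerivAt
  have hGder := ((hgd.sub_const (m : ℂ)).div (hgd.add_const (m : ℂ)) (hne 0 h0)).deriv
  have hmC : (m : ℂ) ≠ 0 := by exact_mod_cast hmpos.ne'
  have hval : deriv G 0 = deriv g 0 / (2 * m) := by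
    change deriv ((fun z => g z - m) / fun z => g z + m) 0 = _
    rw [hGder, hm]
    field_simp
    ring
  rw [hval, norm_div, div_one, div_le_one (by simp [hmpos.ne'])] at hS
  simpa [abs_of_pos hmpos] using hS

/-- A holomorphic map from the unit disc to the slit plane satisfies the Schwarz–Pick
bound at the origin. -/
theorem norm_deriv_zero_le_of_mem_slitPlane {f : ℂ → ℂ}
    (hf : DifferentiableOn ℂ f (Metric.ball 0 1))
    (hslit : ∀ z ∈ Metric.ball (0 : ℂ) 1, f z ∈ slitPlane) {p : ℝ} (hp : 0 < p) (hfp : f 0 = p) :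
    ‖deriv f 0‖ ≤ 4 * p := by
  have h0 : (0 : ℂ) ∈ Metric.ball (0 : ℂ) 1 := by simp
  have hfd : HasDerivAt f (deriv f 0) 0 :=
    (hf.differentiableAt (Metric.ball_mem_nhds _ one_pos)).hasDerivAt
  have hval : cexp (Complex.log (f 0) / 2) = (Real.exp (Real.log p / 2) : ℝ) := by
    rw [hfp, ← Complex.ofReal_log hp.le]
    push_cast
    rfl
  have hbound := norm_deriv_zero_le_of_re_pos (g := fun z => cexp (Complex.log (f z) / 2))
    ((hf.clog hslit).div_const 2).cexp (fun z hz => by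
      rw [Complex.exp_re]
      refine mul_pos (Real.exp_pos _) (Real.cos_pos_of_mem_Ioo ?_)
      have h1 := Complex.neg_pi_lt_arg (f z)
      have h2 := (Complex.arg_le_pi (f z)).lt_of_ne (mem_slitPlane_iff_arg.1 (hslit z hz)).1
      have h3 : (Complex.log (f z) / 2).im = (f z).arg / 2 := by
        simp [Complex.log_im]
      rw [h3]
      constructor <;> linarith) hval
  rw [((hfd.clog (hslit 0 h0)).div_const 2).cexp.deriv, hval, hfp] at hbound
  simp only [norm_mul, norm_div, Complex.norm_real, Real.norm_eq_abs, Real.abs_exp,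
    abs_of_pos hp, Complex.norm_ofNat] at hbound
  have hE := Real.exp_pos (Real.log p / 2)
  rw [mul_comm 2, mul_le_mul_iff_right₀ hE, div_div, div_le_iff₀ (by positivity)] at hbound
  linarith

theorem isOpen_slitDomain (a : ℝ) :
    IsOpen {z : ℂ | z.im ≠ 0 ∨ (a < z.re ∧ z.re < 0)} :=
  (isOpen_ne_fun Complex.continuous_im continuous_const).union
    ((isOpen_lt continuous_const Complex.continuous_re).inter
      (isOpen_lt Complex.continuous_re continuous_const))

theorem differentiableAt_ofReal_of_slitDomain {M : ℂ → ℂ} {a x : ℝ}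
    (hol : DifferentiableOn ℂ M {z : ℂ | z.im ≠ 0 ∨ (a < z.re ∧ z.re < 0)})
    (hx : x ∈ Ioo a 0) : DifferentiableAt ℂ M x :=
  hol.differentiableAt ((isOpen_slitDomain a).mem_nhds (Or.inr (by simpa using hx)))

/-- A holomorphic map from the plane slit along `(-∞, c]` and `[0, ∞)` to the slit plane satisfies
the Schwarz–Pick bound at real points. -/
theorem norm_deriv_le_of_maps_slit {N : ℂ → ℂ} {c x p : ℝ} (hcx : c < x) (hx : x < 0)
    (hN : DifferentiableOn ℂ N {z : ℂ | z.im ≠ 0 ∨ (c < z.re ∧ z.re < 0)})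
    (hslit : ∀ z : ℂ, (z.im ≠ 0 ∨ (c < z.re ∧ z.re < 0)) → N z ∈ slitPlane)
    (hp : 0 < p) (hNp : N x = p) :
    ‖deriv N x‖ * (x * (x - c) / c) ≤ p := by
  have hc : c < 0 := hcx.trans hx
  set k : ℝ := (c - x) / x with hk
  have hkpos : 0 < k := div_pos_of_neg_of_neg (by linarith) hx
  set t : ℂ → ℂ := fun z => (1 + z) / (1 - z) with ht
  set φ : ℂ → ℂ := fun z => c / (1 + k * t z ^ 2) with hφ
  have h1z : ∀ z ∈ Metric.ball (0 : ℂ) 1, 1 - z ≠ 0 := by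
    intro z hz h
    rw [← sub_eq_zero.1 h] at hz
    simp at hz
  have htre : ∀ z ∈ Metric.ball (0 : ℂ) 1, 0 < (t z).re := by
    intro z hz
    have hn : normSq z < 1 := by
      rw [mem_ball_zero_iff] at hz
      rw [← Complex.sq_norm]
      nlinarith [norm_nonneg z]
    have hq : 0 < normSq (1 - z) := normSq_pos.2 (h1z z hz)
    rw [ht]
    simp only [Complex.div_re]
    rw [← add_div]
    refine div_pos ?_ hq
    rw [normSq_apply] at hn
    simp
    nlinarith
  have hwim : ∀ z, (1 + k * t z ^ 2).im = 2 * k * (t z).re * (t z).im := by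
    intro z
    simp [pow_two]
    ring
  have hwre : ∀ z, (1 + k * t z ^ 2).re = 1 + k * ((t z).re ^ 2 - (t z).im ^ 2) := by
    intro z
    simp [pow_two]
  have hcase : ∀ z ∈ Metric.ball (0 : ℂ) 1, (1 + k * t z ^ 2).im ≠ 0 ∨
      ∃ r : ℝ, 1 < r ∧ 1 + k * t z ^ 2 = r := by
    intro z hz
    have h := htre z hz
    by_cases him : (t z).im = 0
    · refine Or.inr ⟨1 + k * (t z).re ^ 2, by nlinarith [mul_pos hkpos (pow_pos h 2)], ?_⟩
      apply Complex.ext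
      · rw [hwre, him, Complex.ofReal_re]; ring
      · rw [hwim, him, Complex.ofReal_im]; ring
    · left
      rw [hwim]
      positivity
  have hwne : ∀ z ∈ Metric.ball (0 : ℂ) 1, 1 + k * t z ^ 2 ≠ 0 := by
    intro z hz h
    rcases hcase z hz with h' | ⟨r, hr, h'⟩
    · simp [h] at h'
    · rw [h] at h'
      have : r = 0 := by exact_mod_cast h'.symm
      linarith
  have hmem : ∀ z ∈ Metric.ball (0 : ℂ) 1,
      (φ z).im ≠ 0 ∨ (c < (φ z).re ∧ (φ z).re < 0) := by
    intro z hz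
    rcases hcase z hz with h | ⟨r, hr, h⟩
    · left
      have hq : normSq (1 + k * t z ^ 2) ≠ 0 := (normSq_pos.2 (hwne z hz)).ne'
      have : (φ z).im = -(c * (1 + k * t z ^ 2).im / normSq (1 + k * t z ^ 2)) := by
        simp only [hφ, Complex.div_im, Complex.ofReal_im, Complex.ofReal_re]
        ring
      rw [this]
      exact neg_ne_zero.2 (div_ne_zero (mul_ne_zero hc.ne h) hq)
    · right
      have : (φ z).re = c / r := by
        simp only [hφ, h]
        rw [← Complex.ofReal_div, Complex.ofReal_re]
      rw [this]
      have hr0 : 0 < r := by linarith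
      exact ⟨by rw [lt_div_iff₀ hr0]; nlinarith, div_neg_of_neg_of_pos hc hr0⟩
  have hφd : DifferentiableOn ℂ φ (Metric.ball 0 1) := by
    refine (differentiableOn_const _).div ((differentiableOn_const _).add
      (((differentiableOn_const _).mul (DifferentiableOn.pow ?_ 2)))) hwne
    exact ((differentiableOn_const _).add differentiableOn_id).div
      ((differentiableOn_const _).sub differentiableOn_id) h1z
  have hxC : (x : ℂ) ≠ 0 := by exact_mod_cast hx.ne
  have hcC : (c : ℂ) ≠ 0 := by exact_mod_cast hc.ne
  have h1k : (1 + k : ℂ) = c / x := by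
    rw [hk]; push_cast; field_simp; ring
  have hφ0 : φ 0 = x := by
    simp only [hφ, ht]
    simp [h1k]
    field_simp
  have hbound := norm_deriv_zero_le_of_mem_slitPlane (hN.comp hφd hmem)
    (fun z hz => hslit _ (hmem z hz)) hp (by simp [hφ0, hNp])
  have hNd : HasDerivAt N (deriv N x) (φ 0) := by
    rw [hφ0]
    exact (differentiableAt_ofReal_of_slitDomain hN ⟨hcx, hx⟩).hasDerivAt
  have htd : HasDerivAt t 2 0 := by
    have := ((hasDerivAt_id (0 : ℂ)).const_add 1).div ((hasDerivAt_id (0 : ℂ)).const_sub 1)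
      (by simp)
    refine this.congr_deriv ?_
    simp; norm_num
  have hφder : HasDerivAt φ (4 * (x * (x - c) / c) : ℝ) 0 := by
    have := (hasDerivAt_const (0 : ℂ) (c : ℂ)).div (((htd.pow 2).const_mul (k : ℂ)).const_add 1)
      (hwne 0 (by simp))
    refine this.congr_deriv ?_
    have ht0 : t 0 = 1 := by simp [ht]
    simp only [Pi.pow_apply, ht0]
    simp only [one_pow, mul_one, h1k]
    rw [hk]; push_cast; field_simp; ring
  rw [(hNd.comp 0 hφder).deriv, norm_mul, Complex.norm_real, Real.norm_eq_abs] at hbound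
  have := mul_le_mul_of_nonneg_left (le_abs_self (4 * (x * (x - c) / c))) (norm_nonneg (deriv N x))
  linarith

theorem isPreconnected_slitDomain {a : ℝ} (ha : a < 0) :
    IsPreconnected {z : ℂ | z.im ≠ 0 ∨ (a < z.re ∧ z.re < 0)} := by
  have hmem : ((a / 2 : ℝ) : ℂ) ∈ {z : ℂ | z.im ≠ 0 ∨ (a < z.re ∧ z.re < 0)} :=
    Or.inr (by rw [Complex.ofReal_re]; constructor <;> linarith)
  have hstar : StarConvex ℝ ((a / 2 : ℝ) : ℂ)
      {z : ℂ | z.im ≠ 0 ∨ (a < z.re ∧ z.re < 0)} := by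
    intro z hz s t hs ht hst
    rcases ht.eq_or_lt with rfl | ht
    · have : s = 1 := by linarith
      simpa [this] using hmem
    · rcases hz with hz | ⟨hz1, hz2⟩
      · left
        simpa using ⟨ht.ne', hz⟩
      · right
        have hs1 : s = 1 - t := by linarith
        simp only [Complex.add_re, Complex.real_smul, Complex.re_ofReal_mul, Complex.ofReal_re]
        constructor <;> nlinarith
  exact (hstar.isPathConnected hmem).isConnected.isPreconnected

section Nevanlinna

variable {M : ℂ → ℂ} {a : ℝ}

/-- The extension of a symmetric function is real on the real interval. -/
theorem im_eq_zero_of_symm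
    (hol : DifferentiableOn ℂ M {z : ℂ | z.im ≠ 0 ∨ (a < z.re ∧ z.re < 0)})
    (hsymm : ∀ z : ℂ, z.im ≠ 0 → M ((starRingEnd ℂ) z) = (starRingEnd ℂ) (M z))
    {x : ℝ} (hx : x ∈ Ioo a 0) : (M x).im = 0 := by
  have hc : ContinuousAt M x :=
    (differentiableAt_ofReal_of_slitDomain hol hx).continuousAt
  have hup : Tendsto (fun y : ℝ => (x : ℂ) + y * I) (nhdsWithin 0 (Ioi 0)) (nhds x) := by
    have : Continuous (fun y : ℝ => (x : ℂ) + y * I) := by fun_prop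
    simpa using (this.tendsto 0).mono_left nhdsWithin_le_nhds
  have hlow : Tendsto (fun y : ℝ => (starRingEnd ℂ) ((x : ℂ) + y * I))
      (nhdsWithin 0 (Ioi 0)) (nhds x) := by
    have := (Complex.continuous_conj.tendsto _).comp hup
    rwa [Complex.conj_ofReal] at this
  have h1 := (Complex.continuous_conj.tendsto _).comp (hc.tendsto.comp hup)
  have h2 := hc.tendsto.comp hlow
  have heq : M x = (starRingEnd ℂ) (M x) := by
    refine tendsto_nhds_unique (h2.congr' ?_) h1
    filter_upwards [self_mem_nhdsWithin] with y hy
    exact hsymm _ (by simpa using (ne_of_gt hy : y ≠ 0))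
  exact Complex.conj_eq_iff_im.1 heq.symm

/-- The derivative of a Nevanlinna function is nonnegative on the real interval. -/
theorem re_deriv_nonneg
    (hol : DifferentiableOn ℂ M {z : ℂ | z.im ≠ 0 ∨ (a < z.re ∧ z.re < 0)})
    (hsymm : ∀ z : ℂ, z.im ≠ 0 → M ((starRingEnd ℂ) z) = (starRingEnd ℂ) (M z))
    (him : ∀ z : ℂ, 0 < z.im → 0 ≤ (M z).im)
    {x : ℝ} (hx : x ∈ Ioo a 0) : 0 ≤ (deriv M x).re := by
  have hd : HasDerivAt M (deriv M x) ((x : ℂ) + (0 : ℝ) * I) := by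
    simpa using (differentiableAt_ofReal_of_slitDomain hol hx).hasDerivAt
  have hline : HasDerivAt (fun y : ℝ => (x : ℂ) + y * I) I 0 := by
    simpa using ((Complex.ofRealCLM.hasDerivAt (x := 0)).mul_const I).const_add (x : ℂ)
  have hM : HasDerivAt (fun y : ℝ => M (x + y * I)) (deriv M x * I) 0 :=
    hd.comp (0 : ℝ) hline
  have hIm : HasDerivAt (fun y : ℝ => (M (x + y * I)).im) (deriv M x).re 0 := by
    exact (Complex.imCLM.hasFDerivAt.comp_hasDerivAt (0 : ℝ) hM).congr_deriv (by simp)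
  have hslope := hIm.tendsto_slope_zero_right
  refine ge_of_tendsto hslope ?_
  filter_upwards [self_mem_nhdsWithin] with y hy
  have hy' : (0 : ℝ) < y := hy
  have h1 := him ((x : ℂ) + y * I) (by simpa using hy')
  have h2 := im_eq_zero_of_symm hol hsymm hx
  simp only [zero_add, smul_eq_mul, Complex.ofReal_zero, zero_mul, add_zero, h2, sub_zero]
  positivity

theorem hasDerivAt_re_ofReal
    (hol : DifferentiableOn ℂ M {z : ℂ | z.im ≠ 0 ∨ (a < z.re ∧ z.re < 0)})
    {x : ℝ} (hx : x ∈ Ioo a 0) :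
    HasDerivAt (fun y : ℝ => (M y).re) (deriv M x).re x :=
  (differentiableAt_ofReal_of_slitDomain hol hx).hasDerivAt.real_of_complex

theorem monotoneOn_re_ofReal
    (hol : DifferentiableOn ℂ M {z : ℂ | z.im ≠ 0 ∨ (a < z.re ∧ z.re < 0)})
    (hsymm : ∀ z : ℂ, z.im ≠ 0 → M ((starRingEnd ℂ) z) = (starRingEnd ℂ) (M z))
    (him : ∀ z : ℂ, 0 < z.im → 0 ≤ (M z).im) :
    MonotoneOn (fun y : ℝ => (M y).re) (Ioo a 0) := by
  refine monotoneOn_of_deriv_nonneg (convex_Ioo a 0)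
    (fun x hx => (hasDerivAt_re_ofReal hol hx).continuousAt.continuousWithinAt) ?_ ?_
  · intro x hx
    rw [interior_Ioo] at hx
    exact (hasDerivAt_re_ofReal hol hx).differentiableAt.differentiableWithinAt
  · intro x hx
    rw [interior_Ioo] at hx
    rw [(hasDerivAt_re_ofReal hol hx).deriv]
    exact re_deriv_nonneg hol hsymm him hx

/-- A Nevanlinna function that is not identically zero has constant strict sign on some
interval `(c, 0)`. -/
theorem exists_sign_near_zero (ha : a < 0)
    (hol : DifferentiableOn ℂ M {z : ℂ | z.im ≠ 0 ∨ (a < z.re ∧ z.re < 0)})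
    (hsymm : ∀ z : ℂ, z.im ≠ 0 → M ((starRingEnd ℂ) z) = (starRingEnd ℂ) (M z))
    (him : ∀ z : ℂ, 0 < z.im → 0 ≤ (M z).im)
    (hne : ∃ z : ℂ, z.im ≠ 0 ∧ M z ≠ 0) :
    ∃ c ∈ Ico a 0, (∀ x ∈ Ioo c 0, (M (x : ℝ)).re < 0) ∨ ∀ x ∈ Ioo c 0, 0 < (M (x : ℝ)).re := by
  have hmono := monotoneOn_re_ofReal hol hsymm him
  by_cases hneg : ∀ x ∈ Ioo a 0, (M (x : ℝ)).re < 0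
  · exact ⟨a, ⟨le_rfl, ha⟩, Or.inl hneg⟩
  push Not at hneg
  obtain ⟨x₁, hx₁, h₁⟩ := hneg
  by_cases hpos : ∀ x ∈ Ioo x₁ 0, 0 < (M (x : ℝ)).re
  · exact ⟨x₁, ⟨hx₁.1.le, hx₁.2⟩, Or.inr hpos⟩
  push Not at hpos
  obtain ⟨x₂, hx₂, h₂⟩ := hpos
  have hx₂a : x₂ ∈ Ioo a 0 := ⟨hx₁.1.trans hx₂.1, hx₂.2⟩
  have hzero : ∀ y ∈ Ioo x₁ x₂, M (y : ℝ) = 0 := by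
    intro y hy
    have hya : y ∈ Ioo a 0 := ⟨hx₁.1.trans hy.1, hy.2.trans hx₂.2⟩
    have hlow := hmono hx₁ hya hy.1.le
    have hupp := hmono hya hx₂a hy.2.le
    refine Complex.ext ?_ (im_eq_zero_of_symm hol hsymm hya)
    simp only at hlow hupp
    exact le_antisymm (hupp.trans h₂) (h₁.trans hlow)
  obtain ⟨y, hy⟩ := exists_between hx₂.1
  have hya : y ∈ Ioo a 0 := ⟨hx₁.1.trans hy.1, hy.2.trans hx₂.2⟩
  have hreal : Tendsto (fun t : ℝ => (t : ℂ)) (nhdsWithin y {y}ᶜ) (nhdsWithin (y : ℂ) {(y : ℂ)}ᶜ) :=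
    tendsto_nhdsWithin_iff.2 ⟨(Complex.continuous_ofReal.tendsto y).mono_left nhdsWithin_le_nhds, by
      filter_upwards [self_mem_nhdsWithin] with t ht
      simpa using ht⟩
  have hfreq : ∃ᶠ z in nhdsWithin (y : ℂ) {(y : ℂ)}ᶜ, M z = 0 := by
    refine hreal.frequently (Eventually.frequently ?_)
    filter_upwards [nhdsWithin_le_nhds (Ioo_mem_nhds hy.1 hy.2)] with t ht
    exact hzero t ht
  have hall := (hol.analyticOnNhd
    (isOpen_slitDomain a)).eqOn_zero_of_preconnected_of_frequently_eq_zero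
    (isPreconnected_slitDomain ha) (z₀ := (y : ℂ)) (Or.inr (by simpa using hya)) hfreq
  obtain ⟨z, hz, hMz⟩ := hne
  exact absurd (hall (Or.inl hz)) hMz

/-- Upper bound for the logarithmic derivative of a Nevanlinna function which is positive
on `(c, 0)`. -/
theorem norm_deriv_mul_le_re {c : ℝ}
    (hol : DifferentiableOn ℂ M {z : ℂ | z.im ≠ 0 ∨ (c < z.re ∧ z.re < 0)})
    (hsymm : ∀ z : ℂ, z.im ≠ 0 → M ((starRingEnd ℂ) z) = (starRingEnd ℂ) (M z))
    (him : ∀ z : ℂ, 0 < z.im → 0 ≤ (M z).im)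
    (hpos : ∀ x ∈ Ioo c 0, 0 < (M (x : ℝ)).re) {x : ℝ} (hx : x ∈ Ioo c 0) :
    ‖deriv M x‖ * (x * (x - c) / c) ≤ (M x).re := by
  have hreal : ∀ y ∈ Ioo c 0, M (y : ℝ) = ((M y).re : ℝ) := fun y hy =>
    Complex.ext (by simp) (by simpa using im_eq_zero_of_symm hol hsymm hy)
  have hdM := (differentiableAt_ofReal_of_slitDomain hol hx).hasDerivAt
  have hδ : ∀ δ > (0 : ℝ), ‖deriv M x + δ‖ * (x * (x - c) / c) ≤ (M x).re + δ * (x - c) := by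
    intro δ hδ
    have hder : deriv (fun z : ℂ => M z + δ * (z - c)) x = deriv M x + δ := by
      exact ((hdM.add (((hasDerivAt_id (x : ℂ)).sub_const (c : ℂ)).const_mul (δ : ℂ))).congr_deriv
        (by simp)).deriv
    rw [← hder]
    have hup : ∀ z : ℂ, 0 < z.im → 0 < (M z + δ * (z - c)).im := by
      intro z hz
      have := him z hz
      have h2 := mul_pos hδ hz
      simp
      linarith
    refine norm_deriv_le_of_maps_slit hx.1 hx.2 (hol.add (by fun_prop)) ?_ ?_ ?_
    · intro z hz
      by_cases h : z.im = 0
      · left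
        have hz' : z.re ∈ Ioo c 0 := hz.resolve_left (not_not.2 h)
        have hzr : z = (z.re : ℝ) := Complex.ext (by simp) (by simpa using h)
        have h1 := hpos _ hz'
        rw [← hzr] at h1
        have h2 := mul_pos hδ (sub_pos.2 hz'.1)
        simp
        linarith
      · right
        rcases lt_or_gt_of_ne h with h | h
        · have h1 := hup ((starRingEnd ℂ) z) (by simpa using h)
          rw [hsymm z h.ne] at h1
          simp at h1 ⊢
          linarith
        · exact (hup z h).ne'
    · exact add_pos (hpos x hx) (mul_pos hδ (sub_pos.2 hx.1))
    · rw [hreal x hx]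
      push_cast
      simp
  have hL : Tendsto (fun δ : ℝ => ‖deriv M x + δ‖ * (x * (x - c) / c)) (nhdsWithin 0 (Ioi 0))
      (nhds (‖deriv M x‖ * (x * (x - c) / c))) := by
    have : Continuous (fun δ : ℝ => ‖deriv M x + δ‖ * (x * (x - c) / c)) := by fun_prop
    simpa using (this.tendsto 0).mono_left nhdsWithin_le_nhds
  have hR : Tendsto (fun δ : ℝ => (M x).re + δ * (x - c)) (nhdsWithin 0 (Ioi 0))
      (nhds (M x).re) := by
    have : Continuous (fun δ : ℝ => (M x).re + δ * (x - c)) := by fun_prop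
    simpa using (this.tendsto 0).mono_left nhdsWithin_le_nhds
  exact le_of_tendsto_of_tendsto hL hR (by
    filter_upwards [self_mem_nhdsWithin] with δ h using hδ δ h)

end Nevanlinna

/-- Let `M` be a Nevanlinna function, not identically zero, which
extends holomorphically to `(ℂ∖ℝ) ∪ (−γ, 0)`, and let `R(z) = z² M(z)`. Then
`R′(x)/R(x) → −∞` as `x ↑ 0`. -/
theorem statement15 (M : ℂ → ℂ) (γ : ℝ) (hγ : 0 < γ)
    (hol : DifferentiableOn ℂ M {z : ℂ | z.im ≠ 0 ∨ (-γ < z.re ∧ z.re < 0)})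
    (hsymm : ∀ z : ℂ, z.im ≠ 0 → M ((starRingEnd ℂ) z) = (starRingEnd ℂ) (M z))
    (him : ∀ z : ℂ, 0 < z.im → 0 ≤ (M z).im)
    (hne : ∃ z : ℂ, z.im ≠ 0 ∧ M z ≠ 0)
    (R : ℂ → ℂ) (hR : ∀ z : ℂ, R z = z ^ 2 * M z) :
    Tendsto (fun x : ℝ => (deriv R (x : ℂ)).re / (R (x : ℂ)).re)
      (nhdsWithin 0 (Set.Iio 0)) atBot := by
  obtain rfl : R = fun z => z ^ 2 * M z := funext hR
  obtain ⟨c, ⟨hac, hc⟩, hsign⟩ := exists_sign_near_zero (neg_lt_zero.2 hγ) hol hsymm him hne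
  have hquot : ∀ x ∈ Ioo c 0, (M (x : ℝ)).re ≠ 0 →
      (deriv (fun z : ℂ => z ^ 2 * M z) (x : ℂ)).re / ((x : ℂ) ^ 2 * M x).re =
        2 * x⁻¹ + (deriv M x).re / (M x).re := by
    intro x hx hMx
    have hx0 : x ≠ 0 := hx.2.ne
    have hdM := (differentiableAt_ofReal_of_slitDomain hol ⟨hac.trans_lt hx.1, hx.2⟩).hasDerivAt
    have hd : deriv (fun z : ℂ => z ^ 2 * M z) (x : ℂ)
        = ((2 * x : ℝ) : ℂ) * M x + ((x ^ 2 : ℝ) : ℂ) * deriv M x := by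
      refine (((hasDerivAt_pow 2 (x : ℂ)).mul hdM).congr_deriv ?_).deriv
      simp
    rw [hd, ← Complex.ofReal_pow, Complex.add_re, Complex.re_ofReal_mul, Complex.re_ofReal_mul,
      Complex.re_ofReal_mul]
    field_simp
  have hbound : ∀ x ∈ Ioo (c / 2) 0,
      (deriv (fun z : ℂ => z ^ 2 * M z) (x : ℂ)).re / ((x : ℂ) ^ 2 * M x).re
        ≤ x⁻¹ + 2 / (-c) := by
    intro x hx
    have hxc : x ∈ Ioo c 0 := ⟨by linarith [hx.1], hx.2⟩
    have hxinv : x⁻¹ < 0 := inv_lt_zero.2 hx.2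
    have hcpos : 0 < 2 / (-c) := div_pos two_pos (by linarith)
    rcases hsign with hneg | hpos
    · have hM := hneg x hxc
      rw [hquot x hxc hM.ne]
      have hder := re_deriv_nonneg hol hsymm him (x := x) ⟨hac.trans_lt hxc.1, hxc.2⟩
      have := div_nonpos_of_nonneg_of_nonpos hder hM.le
      linarith
    · have hM := hpos x hxc
      rw [hquot x hxc hM.ne']
      have hk := norm_deriv_mul_le_re (hol.mono fun z hz =>
        hz.imp_right fun h => ⟨hac.trans_lt h.1, h.2⟩) hsymm him hpos hxc
      have hq : 0 < x * (x - c) / c :=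
        div_pos_of_neg_of_neg (mul_neg_of_neg_of_pos hx.2 (sub_pos.2 hxc.1)) hc
      have hlog : (deriv M x).re / (M x).re ≤ (x * (x - c) / c)⁻¹ := by
        rw [div_le_iff₀ hM, inv_mul_eq_div, le_div_iff₀ hq]
        exact (mul_le_mul_of_nonneg_right (Complex.re_le_norm _) hq.le).trans hk
      have hxc0 : 0 < x - c := sub_pos.2 hxc.1
      have hpartial : (x * (x - c) / c)⁻¹ = (x - c)⁻¹ - x⁻¹ := by
        have := hx.2.ne
        have := hc.ne
        field_simp
        ring
      have hlast : (x - c)⁻¹ ≤ 2 / (-c) := by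
        rw [inv_eq_one_div, div_le_div_iff₀ hxc0 (by linarith)]
        linarith [hx.1]
      linarith
  refine tendsto_atBot_mono' _ ?_ (tendsto_atBot_add_const_right _ (2 / (-c))
    tendsto_inv_nhdsLT_zero)
  filter_upwards [Ioo_mem_nhdsLT (show c / 2 < 0 by linarith)] with x hx using hbound x hx
end
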